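/- Let C be an (n,k,δ) convolutional code over F_q such that all Forney indices of the dual code Ĉ are at most 1 (r̂ = δ). Let Λ and Λ̂ be the adjacency matrices of minimal encoders G and Ĝ of C and Ĉ. Set Q := −B̂^t D̂ C^t ∈ GL_δ(F). Then Λ̂ = q^{−k} 𝐇(𝒫(Q) H Λ^t H^{−1} 𝒫(Q)^{−1}), where H is the MacWilliams matrix on F^δ, 𝒫(Q) the permutation matrix induced by Q, and the MacWilliams transformation 𝐇 is applied entrywise. -/

import Mathlib

open Matrix

open Classical in
/-- The (Hamming) weight enumerator of a subset `S ⊆ F^n`. -/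
noncomputable def we {n : ℕ} {F : Type} [Fintype F] [DecidableEq F] [Zero F]
    (S : Set (Fin n → F)) : Polynomial ℂ :=
  ∑ a : Fin n → F, if a ∈ S then Polynomial.X ^ hammingNorm a else 0

/-- The MacWilliams transformation `𝐇` on `ℂ[W]_{≤n}`:
`𝐇(f) = (1+(q-1)W)^n f((1-W)/(1+(q-1)W)) = ∑_{j≤n} f_j (1-W)^j (1+(q-1)W)^{n-j}`. -/
noncomputable def macwTrafo (q n : ℕ) (f : Polynomial ℂ) : Polynomial ℂ :=
  ∑ j ∈ Finset.range (n + 1),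
    Polynomial.C (f.coeff j) *
      ((1 - Polynomial.X) ^ j * (1 + Polynomial.C ((q : ℂ) - 1) * Polynomial.X) ^ (n - j))

section helpers
variable {F : Type} [Field F] [Fintype F] [DecidableEq F]

lemma aux_map_sum {ι : Type*} (ψ : AddChar F ℂ) (t : Finset ι) (f : ι → F) :
    ψ (∑ i ∈ t, f i) = ∏ i ∈ t, ψ (f i) := by
  classical
  induction t using Finset.induction_on with
  | empty => simp
  | insert a t ha ih => rw [Finset.sum_insert ha, Finset.prod_insert ha, AddChar.map_add_eq_mul, ih]

lemma aux_sum_char {ι : Type*} [Fintype ι] [DecidableEq ι] (ψ : AddChar F ℂ)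
    (hψ : ψ.IsPrimitive) (c : ι → F) :
    ∑ x : ι → F, ψ (x ⬝ᵥ c) = if c = 0 then (Fintype.card F : ℂ) ^ Fintype.card ι else 0 := by
  have h1 : ∀ x : ι → F, ψ (x ⬝ᵥ c) = ∏ i, ψ (x i * c i) := by
    intro x
    rw [dotProduct, aux_map_sum]
  simp_rw [h1]
  rw [← Fintype.prod_sum (fun i (a : F) => ψ (a * c i))]
  simp_rw [AddChar.sum_mulShift _ hψ]
  split_ifs with h
  · subst h; simp
  · obtain ⟨i, hi⟩ := Function.ne_iff.mp h
    apply Finset.prod_eq_zero (Finset.mem_univ i)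
    simp at hi
    simp [hi]

lemma aux_macw_monomial {n : ℕ} (ψ : AddChar F ℂ) (hψ : ψ.IsPrimitive) (v : Fin n → F) :
    macwTrafo (Fintype.card F) n (Polynomial.X ^ hammingNorm v)
      = ∑ a : Fin n → F, Polynomial.C (ψ (a ⬝ᵥ v)) * Polynomial.X ^ hammingNorm a := by
  have hle : hammingNorm v ≤ n := by simpa using hammingNorm_le_card_fintype (x := v)
  have h1 : ∀ a : Fin n → F, Polynomial.C (ψ (a ⬝ᵥ v)) * Polynomial.X ^ hammingNorm a
      = ∏ i, (Polynomial.C (ψ (a i * v i)) * (if a i = 0 then 1 else Polynomial.X)) := by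
    intro a
    rw [dotProduct, aux_map_sum, map_prod, Finset.prod_mul_distrib]
    congr 1
    rw [Finset.prod_ite]
    simp [hammingNorm]
  simp_rw [h1]
  rw [← Fintype.prod_sum (fun i (a : F) => (Polynomial.C (ψ (a * v i)) *
    (if a = 0 then 1 else Polynomial.X : Polynomial ℂ)))]
  have h2 : ∀ i, ∑ a : F, (Polynomial.C (ψ (a * v i)) *
      (if a = 0 then 1 else Polynomial.X : Polynomial ℂ))
      = if v i = 0 then (1 + Polynomial.C ((Fintype.card F : ℂ) - 1) * Polynomial.X)
        else 1 - Polynomial.X := by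
    intro i
    have h3 := AddChar.sum_mulShift (v i) hψ
    rw [← Finset.add_sum_erase _ _ (Finset.mem_univ (0 : F))] at h3 ⊢
    have h4 : ∑ a ∈ Finset.univ.erase (0 : F), (Polynomial.C (ψ (a * v i)) *
      (if a = 0 then 1 else Polynomial.X : Polynomial ℂ)) =
      Polynomial.C (∑ a ∈ Finset.univ.erase (0 : F), ψ (a * v i)) * Polynomial.X := by
      rw [map_sum, Finset.sum_mul]
      apply Finset.sum_congr rfl
      intro a ha
      rw [if_neg (Finset.ne_of_mem_erase ha)]
    rw [h4]
    have h5 : ∑ a ∈ Finset.univ.erase (0 : F), ψ (a * v i)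
        = (if v i = 0 then (Fintype.card F : ℂ) else 0) - 1 := by
      rw [eq_sub_iff_add_eq, add_comm]
      simpa using h3
    rw [h5]
    rw [if_pos rfl]
    split_ifs <;> simp
    ring
  simp_rw [h2]
  rw [macwTrafo, Finset.sum_eq_single (hammingNorm v)]
  · rw [Finset.prod_ite]
    simp only [Polynomial.coeff_X_pow_self, map_one, one_mul, Finset.prod_const]
    rw [mul_comm]
    have : (Finset.univ.filter (fun i => v i = 0)).card = n - hammingNorm v := by
      have := Finset.card_filter_add_card_filter_not (s := (Finset.univ : Finset (Fin n))) (fun i => v i = 0)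
      simp only [hammingNorm, Finset.card_univ, Fintype.card_fin] at this ⊢
      simp only [ne_eq]
      omega
    rw [this]
    rfl
  · intro j _ hj
    simp [Polynomial.coeff_X_pow, hj]
  · intro h
    simp at h
    omega

noncomputable def auxMacwL (q n : ℕ) : Polynomial ℂ →ₗ[ℂ] Polynomial ℂ where
  toFun := macwTrafo q n
  map_add' f g := by
    simp [macwTrafo, add_mul, Finset.sum_add_distrib]
  map_smul' c f := by
    simp [macwTrafo, Finset.smul_sum, Polynomial.smul_eq_C_mul, mul_assoc]

open Classical in
lemma aux_we_filter {n : ℕ} (S : Set (Fin n → F)) :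
    we S = ∑ a ∈ Finset.univ.filter (fun a => a ∈ S), Polynomial.X ^ hammingNorm a := by
  rw [Finset.sum_filter]
  rfl

/-- the analytic half -/
lemma aux_transform {n : ℕ} {κ I : Type*} [Fintype κ] [DecidableEq κ] [Fintype I] [DecidableEq I]
    (ψ : AddChar F ℂ) (hψ : ψ.IsPrimitive)
    (A : Matrix I I F) (B : Matrix κ I F) (Cm : Matrix I (Fin n) F) (D : Matrix κ (Fin n) F)
    (hinj : ∀ u : κ → F, u ᵥ* D = 0 → u = 0)
    (Λ : Matrix (I → F) (I → F) (Polynomial ℂ))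
    (hΛ : ∀ X Y, Λ X Y
      = we {v | ∃ u : κ → F, Y = X ᵥ* A + u ᵥ* B ∧ v = X ᵥ* Cm + u ᵥ* D})
    (H : Matrix (I → F) (I → F) ℂ) (c : ℂ)
    (hc : c * c * (Fintype.card F : ℂ) ^ Fintype.card I = 1)
    (hH : ∀ X Y, H X Y = c * ψ (X ⬝ᵥ Y)) (X Y : I → F) :
    ((Fintype.card F : ℂ) ^ Fintype.card κ)⁻¹ • macwTrafo (Fintype.card F) n
      ((H.map Polynomial.C * Λᵀ * (H⁻¹).map Polynomial.C) X Y)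
    = we {a | A *ᵥ X - Y + Cm *ᵥ a = 0 ∧ B *ᵥ X + D *ᵥ a = 0} := by
  classical
  have hHinv : H⁻¹ = Matrix.of (fun X Y => c * ψ (-(X ⬝ᵥ Y))) := by
    apply Matrix.inv_eq_right_inv
    ext P R
    have : ∀ Z, H P Z * (c * ψ (-(Z ⬝ᵥ R))) = c * c * ψ (Z ⬝ᵥ (P - R)) := by
      intro Z
      rw [hH, dotProduct_sub, sub_eq_add_neg, AddChar.map_add_eq_mul, dotProduct_comm P Z]
      ring
    simp only [Matrix.mul_apply, Matrix.of_apply, this, ← Finset.mul_sum, aux_sum_char ψ hψ,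
      sub_eq_zero, Matrix.one_apply]
    split_ifs
    · exact hc
    · simp
  have hΛ' : ∀ W Z, Λ W Z = ∑ u : κ → F, if Z = W ᵥ* A + u ᵥ* B then
      Polynomial.X ^ hammingNorm (W ᵥ* Cm + u ᵥ* D) else 0 := by
    intro W Z
    rw [hΛ, aux_we_filter, ← Finset.sum_filter]
    symm
    apply Finset.sum_bij (fun u _ => W ᵥ* Cm + u ᵥ* D)
    · intro u hu
      simp only [Finset.mem_filter, Finset.mem_univ, true_and] at hu ⊢
      exact ⟨u, hu, rfl⟩
    · intro u _ u' _ h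
      have h' := add_left_cancel h
      rw [← sub_eq_zero, ← Matrix.sub_vecMul] at h'
      exact sub_eq_zero.mp (hinj _ h')
    · intro b hb
      simp only [Finset.mem_filter, Finset.mem_univ, true_and] at hb
      obtain ⟨u, hu, rfl⟩ := hb
      exact ⟨u, by simpa using hu, rfl⟩
    · intros; rfl
  have hent : (H.map Polynomial.C * Λᵀ * (H⁻¹).map Polynomial.C) X Y
      = ∑ W : I → F, ∑ u : κ → F, (c * c * ψ (X ⬝ᵥ (W ᵥ* A + u ᵥ* B) - W ⬝ᵥ Y)) •
          (Polynomial.X ^ hammingNorm (W ᵥ* Cm + u ᵥ* D) : Polynomial ℂ) := by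
    rw [Matrix.mul_apply]
    apply Finset.sum_congr rfl
    intro W _
    rw [Matrix.mul_apply, Finset.sum_mul]
    simp only [Matrix.transpose_apply, hΛ', Finset.mul_sum, Finset.sum_mul]
    rw [Finset.sum_comm]
    apply Finset.sum_congr rfl
    intro u _
    rw [Finset.sum_eq_single (W ᵥ* A + u ᵥ* B)]
    · rw [if_pos rfl, hHinv]
      simp only [Matrix.map_apply, hH, Matrix.of_apply, Polynomial.smul_eq_C_mul]
      rw [sub_eq_add_neg, AddChar.map_add_eq_mul]
      simp only [map_mul]
      ring
    · intro Z _ hZ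
      simp [hZ]
    · simp
  have hlin : ∀ f, macwTrafo (Fintype.card F) n f = auxMacwL (Fintype.card F) n f := fun _ => rfl
  rw [hent, hlin]
  simp only [map_sum, map_smul]
  simp only [← hlin, aux_macw_monomial ψ hψ]
  have hq : (Fintype.card F : ℂ) ≠ 0 := by simp
  have hre : ∀ (W : I → F) (u : κ → F),
      (c * c * ψ (X ⬝ᵥ (W ᵥ* A + u ᵥ* B) - W ⬝ᵥ Y)) • ∑ a : Fin n → F,
        Polynomial.C (ψ (a ⬝ᵥ (W ᵥ* Cm + u ᵥ* D))) * (Polynomial.X : Polynomial ℂ) ^ hammingNorm a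
      = ∑ a : Fin n → F, (c * c * (ψ (W ⬝ᵥ (A *ᵥ X - Y + Cm *ᵥ a)) *
         ψ (u ⬝ᵥ (B *ᵥ X + D *ᵥ a)))) • (Polynomial.X : Polynomial ℂ) ^ hammingNorm a := by
    intro W u
    rw [Finset.smul_sum]
    apply Finset.sum_congr rfl
    intro a _
    rw [← Polynomial.smul_eq_C_mul, smul_smul, mul_assoc, ← AddChar.map_add_eq_mul,
      ← AddChar.map_add_eq_mul]
    congr 2
    congr 1
    rw [dotProduct_comm X, dotProduct_comm a]
    simp only [dotProduct_add, add_dotProduct, dotProduct_sub, ← Matrix.dotProduct_mulVec]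
    ring
  simp only [hre]
  rw [we]
  have hsw : ∑ W : I → F, ∑ u : κ → F, ∑ a : Fin n → F,
      (c * c * (ψ (W ⬝ᵥ (A *ᵥ X - Y + Cm *ᵥ a)) *
         ψ (u ⬝ᵥ (B *ᵥ X + D *ᵥ a)))) • (Polynomial.X : Polynomial ℂ) ^ hammingNorm a
      = ∑ a : Fin n → F, (c * c * ((∑ W : I → F, ψ (W ⬝ᵥ (A *ᵥ X - Y + Cm *ᵥ a))) *
         (∑ u : κ → F, ψ (u ⬝ᵥ (B *ᵥ X + D *ᵥ a))))) •
          (Polynomial.X : Polynomial ℂ) ^ hammingNorm a := by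
    simp_rw [Finset.sum_mul_sum, Finset.mul_sum, Finset.sum_smul]
    conv_rhs => rw [Finset.sum_comm]
    apply Finset.sum_congr rfl
    intro W _
    rw [Finset.sum_comm]
  rw [hsw, Finset.smul_sum]
  apply Finset.sum_congr rfl
  intro a _
  rw [aux_sum_char ψ hψ, aux_sum_char ψ hψ, smul_smul]
  simp only [Set.mem_ofPred_eq]
  by_cases h1 : A *ᵥ X - Y + Cm *ᵥ a = 0
  · by_cases h2 : B *ᵥ X + D *ᵥ a = 0
    · simp only [h1, h2, if_true, and_self]
      rw [← mul_assoc (c * c), hc, one_mul, inv_mul_cancel₀ (pow_ne_zero _ hq), one_smul]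
    · simp [h2]
  · simp [h1]

lemma aux_we_neg {n : ℕ} (S S' : Set (Fin n → F)) (h : ∀ a, a ∈ S ↔ -a ∈ S') : we S = we S' := by
  classical
  rw [we, we]
  apply Fintype.sum_equiv (Equiv.neg _)
  intro a
  have : hammingNorm (-a) = hammingNorm a := by simp [hammingNorm]
  simp [h a, this]

/-- existence of the character -/
lemma aux_char {p s : ℕ} [Fact p.Prime] (hs : 0 < s) [CharP F p] [Algebra (ZMod p) F]
    (hq : Fintype.card F = p ^ s)
    (ζ : ℂ) (hζ : IsPrimitiveRoot ζ p)
    (τ : F → ZMod p)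
    (hτ : ∀ a : F, algebraMap (ZMod p) F (τ a) = ∑ i ∈ Finset.range s, a ^ p ^ i) :
    ∃ ψ : AddChar F ℂ, ψ.IsPrimitive ∧ ∀ a, ψ a = ζ ^ (τ a).val := by
  have hinj := (algebraMap (ZMod p) F).injective
  have hp1 : 1 < p := (Fact.out : p.Prime).one_lt
  let T : F →+ ZMod p := AddMonoidHom.mk' τ (by
    intro a b
    apply hinj
    rw [map_add, hτ, hτ, hτ, ← Finset.sum_add_distrib]
    apply Finset.sum_congr rfl
    intro i _
    exact add_pow_char_pow a b p i)
  let ψ : AddChar F ℂ := (AddChar.zmodChar p hζ.pow_eq_one).compAddMonoidHom T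
  have hψ : ∀ a, ψ a = ζ ^ (τ a).val := by
    intro a
    simp [ψ, AddChar.zmodChar_apply, T]
  refine ⟨ψ, ?_, hψ⟩
  apply AddChar.IsPrimitive.of_ne_one
  intro h1
  have h0 : ∀ a, τ a = 0 := by
    intro a
    have h2 := hψ a
    rw [h1, AddChar.one_apply] at h2
    have h3 := (hζ.pow_eq_one_iff_dvd _).mp h2.symm
    rw [← ZMod.val_eq_zero]
    exact Nat.eq_zero_of_dvd_of_lt h3 (ZMod.val_lt _)
  let P : Polynomial F := ∑ i ∈ Finset.range s, Polynomial.X ^ p ^ i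
  have hroot : ∀ a, P.eval a = 0 := by
    intro a
    simp only [P, Polynomial.eval_finsetSum, Polynomial.eval_pow, Polynomial.eval_X]
    rw [← hτ, h0, map_zero]
  have hdeg : P.natDegree ≤ p ^ (s - 1) := by
    apply Polynomial.natDegree_sum_le_of_forall_le
    intro i hi
    rw [Polynomial.natDegree_X_pow]
    apply Nat.pow_le_pow_right (by omega)
    have := Finset.mem_range.mp hi
    omega
  have hP : P = 0 := by
    apply Polynomial.eq_zero_of_natDegree_lt_card_of_eval_eq_zero P (f := id) Function.injective_id
      (fun a => hroot a)
    rw [hq]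
    exact lt_of_le_of_lt hdeg (Nat.pow_lt_pow_right hp1 (by omega))
  have hc : P.coeff 1 = 1 := by
    simp only [P, Polynomial.finsetSum_coeff, Polynomial.coeff_X_pow]
    rw [Finset.sum_eq_single 0]
    · simp
    · intro i _ hi
      rw [if_neg]
      exact (Nat.one_lt_pow hi hp1).ne
    · intro h; simp at h; omega
  rw [hP] at hc
  simp at hc

lemma aux_dual {k m n : ℕ} (hkm : k + m = n)
    (G : Matrix (Fin k) (Fin n) (Polynomial F))
    (hGbasic : ∃ G' : Matrix (Fin n) (Fin k) (Polynomial F), G * G' = 1)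
    (Gh : Matrix (Fin m) (Fin n) (Polynomial F))
    (hGhbasic : ∃ Gh' : Matrix (Fin n) (Fin m) (Polynomial F), Gh * Gh' = 1)
    (horth : G * Ghᵀ = 0) (v : Fin n → Polynomial F) (hv : G *ᵥ v = 0) :
    ∃ u : Fin m → Polynomial F, v = u ᵥ* Gh := by
  obtain ⟨G', hG'⟩ := hGbasic
  obtain ⟨Gh', hGh'⟩ := hGhbasic
  have hT : Gh'ᵀ * Ghᵀ = 1 := by rw [← Matrix.transpose_mul, hGh', Matrix.transpose_one]
  have hMN : Matrix.fromRows G Gh'ᵀ * Matrix.fromCols (G' - Ghᵀ * (Gh'ᵀ * G')) Ghᵀ = 1 := by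
    rw [Matrix.fromRows_mul_fromCols, horth, hT, Matrix.mul_sub, Matrix.mul_sub,
      ← Matrix.mul_assoc, horth, hG', ← Matrix.mul_assoc Gh'ᵀ Ghᵀ, hT]
    simp
  have e : Fin k ⊕ Fin m ≃ Fin n := finSumFinEquiv.trans (finCongr hkm)
  have hNM := (Matrix.mul_eq_one_comm_of_equiv e).mp hMN
  rw [Matrix.fromCols_mul_fromRows] at hNM
  refine ⟨Gh'ᵀ *ᵥ v, ?_⟩
  have := congrArg (· *ᵥ v) hNM
  simp only [Matrix.add_mulVec, ← Matrix.mulVec_mulVec, hv, Matrix.mulVec_zero, zero_add,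
    Matrix.one_mulVec] at this
  rw [Matrix.mulVec_transpose Gh] at this
  exact this.symm

lemma aux_key {k m n : ℕ} (hkm : k + m = n)
    (G : Matrix (Fin k) (Fin n) (Polynomial F))
    (hGbasic : ∃ G' : Matrix (Fin n) (Fin k) (Polynomial F), G * G' = 1)
    (Gh : Matrix (Fin m) (Fin n) (Polynomial F)) (dh : Fin m → ℕ)
    (hGhdeg : ∀ i j, (Gh i j).natDegree ≤ dh i)
    (hGhbasic : ∃ Gh' : Matrix (Fin n) (Fin m) (Polynomial F), Gh * Gh' = 1)
    (hGhmin : LinearIndependent F (fun i : Fin m => fun j : Fin n => (Gh i j).coeff (dh i)))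
    (horth : G * Ghᵀ = 0)
    (hdh1 : ∀ i, dh i ≤ 1) (b : Fin n → F)
    (hb : ∀ i t, ∑ j, (G i j).coeff t * b j = 0) :
    ∃ u : Fin m → F, (∀ i, dh i = 1 → u i = 0) ∧ ∀ j, b j = ∑ i, u i * (Gh i j).coeff 0 := by
  obtain ⟨u, hu⟩ := aux_dual hkm G hGbasic Gh hGhbasic horth (fun j => Polynomial.C (b j)) (by
    ext i t
    simp [Matrix.mulVec, dotProduct, hb])
  have hcoef : ∀ j t, (Polynomial.C (b j)).coeff (t + 1) =
      ∑ i, ((u i).coeff (t + 1) * (Gh i j).coeff 0 + (u i).coeff t * (Gh i j).coeff 1) := by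
    intro j t
    have h := congrArg (fun f => (f j).coeff (t + 1)) hu
    simp only [Matrix.vecMul, dotProduct, Polynomial.finsetSum_coeff] at h
    rw [h]
    apply Finset.sum_congr rfl
    intro i _
    have hd : (Gh i j).natDegree ≤ 1 := (hGhdeg i j).trans (hdh1 i)
    rw [Polynomial.eq_X_add_C_of_natDegree_le_one hd, mul_add, ← mul_assoc,
      Polynomial.coeff_add, Polynomial.coeff_mul_X, Polynomial.coeff_mul_C, Polynomial.coeff_mul_C]
    simp
    ring
  have hz : ∀ r N, N + r = (Finset.univ.sup (fun i => (u i).natDegree)) + 1 →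
      ∀ i, (u i).coeff (N + 1 - dh i) = 0 := by
    intro r
    induction r with
    | zero =>
      intro N hN i
      apply Polynomial.coeff_eq_zero_of_natDegree_lt
      have h1 : (u i).natDegree ≤ Finset.univ.sup (fun i => (u i).natDegree) :=
        Finset.le_sup (f := fun i => (u i).natDegree) (Finset.mem_univ i)
      have h2 := hdh1 i
      omega
    | succ r ih =>
      intro N hN
      have ih' := ih (N + 1) (by omega)
      apply Fintype.linearIndependent_iff.mp hGhmin (fun i => (u i).coeff (N + 1 - dh i))
      ext j
      have h := hcoef j N
      rw [Polynomial.coeff_C_succ] at h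
      simp only [Finset.sum_apply, Pi.smul_apply, smul_eq_mul, Pi.zero_apply]
      rw [h]
      apply Finset.sum_congr rfl
      intro i _
      have h3 := hdh1 i
      rcases (show dh i = 0 ∨ dh i = 1 by omega) with h0 | h0
      · have : (Gh i j).coeff 1 = 0 := by
          apply Polynomial.coeff_eq_zero_of_natDegree_lt
          have := hGhdeg i j
          omega
        simp [h0, this]
      · have h4 := ih' i
        rw [h0] at h4 ⊢
        simp only [Nat.add_sub_cancel] at h4 ⊢
        rw [h4]
        simp
  refine ⟨fun i => (u i).coeff 0, ?_, ?_⟩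
  · intro i hi
    have := hz (Finset.univ.sup (fun i => (u i).natDegree) + 1) 0 (by omega) i
    simpa [hi] using this
  · intro j
    have h := congrArg (fun f => (f j).coeff 0) hu
    simpa [Matrix.vecMul, dotProduct, Polynomial.finsetSum_coeff, Polynomial.mul_coeff_zero] using h

lemma aux_rows_inj {m n : ℕ} (Gh : Matrix (Fin m) (Fin n) (Polynomial F))
    (hGhbasic : ∃ Gh' : Matrix (Fin n) (Fin m) (Polynomial F), Gh * Gh' = 1)
    (Dh : Matrix (Fin m) (Fin n) F) (hDh : ∀ i j, Dh i j = (Gh i j).coeff 0)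
    (u : Fin m → F) (hu : u ᵥ* Dh = 0) : u = 0 := by
  obtain ⟨G', hG'⟩ := hGhbasic
  have h1 : Dh * G'.map (Polynomial.constantCoeff) = 1 := by
    have : Dh = Gh.map Polynomial.constantCoeff := by ext i j; simp [hDh]
    rw [this, ← Matrix.map_mul, hG']
    simp
  have := congrArg (· ᵥ* G'.map (Polynomial.constantCoeff)) hu
  simpa [Matrix.vecMul_vecMul, h1] using this

lemma aux_inverse {I J : Type*} [Fintype I] [Fintype J] [DecidableEq I] [DecidableEq J]
    (hcard : Fintype.card J = Fintype.card I) (M : Matrix J I F)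
    (hinj : ∀ w : J → F, Mᵀ *ᵥ w = 0 → w = 0) :
    ∃ N : Matrix I J F, (-M) * N = 1 ∧ N * (-M) = 1 := by
  let e : J ≃ I := Fintype.equivOfCardEq hcard
  have hS : IsUnit (Mᵀ.submatrix e id) := by
    rw [← Matrix.mulVec_injective_iff_isUnit]
    rw [← Matrix.coe_mulVecLin, injective_iff_map_eq_zero]
    intro w hw
    apply hinj
    ext i
    have := congrFun hw (e.symm i)
    simpa [Matrix.mulVec, dotProduct] using this
  obtain ⟨T, hT⟩ := hS.exists_left_inv
  have h1 : (T.submatrix id e.symm) * Mᵀ = 1 := by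
    rw [← hT]
    ext a b
    simp only [Matrix.mul_apply, Matrix.submatrix_apply, id]
    apply Fintype.sum_equiv e.symm
    intro x
    simp
  have h2 := congrArg Matrix.transpose h1
  rw [Matrix.transpose_mul, Matrix.transpose_transpose, Matrix.transpose_one] at h2
  have h3 : (-M) * (-(T.submatrix id e.symm)ᵀ) = 1 := by simpa using h2
  exact ⟨_, h3, (Matrix.mul_eq_one_comm_of_equiv e).mp h3⟩

end helpers

/-- (MacWilliams Identity, case `r̂ = δ`.)  Let `C` be an `(n,k,δ)`
convolutional code over `F_q` whose dual `Ĉ` has all Forney indices at most `1`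
(exactly `δ` of them equal to `1`).  Let `Λ` and `Λ̂` be the adjacency matrices of
minimal basic encoders `G`, `Ĝ` with controller canonical forms `(A,B,Cm,D)` and
`(Â,B̂,Ĉm,D̂)`.  Then `Q := −B̂ᵀD̂Cmᵀ` is invertible and
`Λ̂ = q^{−k} 𝐇(𝒫(Q) H Λᵀ H⁻¹ 𝒫(Q)⁻¹)`, with `H` the MacWilliams matrix on `F^δ`,
`𝒫(Q)` the permutation matrix induced by `Q` and `𝐇` applied entrywise. -/
theorem stmt_19 {p s k m n : ℕ} [Fact p.Prime] (hs : 0 < s) (hkm : k + m = n)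
    {F : Type} [Field F] [Fintype F] [DecidableEq F] [CharP F p] [Algebra (ZMod p) F]
    (hq : Fintype.card F = p ^ s)
    (ζ : ℂ) (hζ : IsPrimitiveRoot ζ p)
    (τ : F → ZMod p)
    (hτ : ∀ a : F, algebraMap (ZMod p) F (τ a) = ∑ i ∈ Finset.range s, a ^ p ^ i)
    (G : Matrix (Fin k) (Fin n) (Polynomial F)) (d : Fin k → ℕ)
    (hGdeg : ∀ i j, (G i j).natDegree ≤ d i)
    (hGbasic : ∃ G' : Matrix (Fin n) (Fin k) (Polynomial F), G * G' = 1)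
    (hGmin : LinearIndependent F (fun i : Fin k => fun j : Fin n => (G i j).coeff (d i)))
    (Gh : Matrix (Fin m) (Fin n) (Polynomial F)) (dh : Fin m → ℕ)
    (hGhdeg : ∀ i j, (Gh i j).natDegree ≤ dh i)
    (hGhbasic : ∃ Gh' : Matrix (Fin n) (Fin m) (Polynomial F), Gh * Gh' = 1)
    (hGhmin : LinearIndependent F (fun i : Fin m => fun j : Fin n => (Gh i j).coeff (dh i)))
    (horth : G * Ghᵀ = 0)
    (hdh1 : ∀ i, dh i ≤ 1)
    (hrhat : ∑ i, dh i = ∑ i, d i)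
    (A : Matrix (Σ i, Fin (d i)) (Σ i, Fin (d i)) F)
    (B : Matrix (Fin k) (Σ i, Fin (d i)) F)
    (Cm : Matrix (Σ i, Fin (d i)) (Fin n) F)
    (D : Matrix (Fin k) (Fin n) F)
    (hA : ∀ x y, A x y = if x.1 = y.1 ∧ (x.2 : ℕ) + 1 = (y.2 : ℕ) then 1 else 0)
    (hB : ∀ i y, B i y = if i = y.1 ∧ (y.2 : ℕ) = 0 then 1 else 0)
    (hC : ∀ x j, Cm x j = (G x.1 j).coeff ((x.2 : ℕ) + 1))
    (hD : ∀ i j, D i j = (G i j).coeff 0)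
    (Ah : Matrix (Σ i, Fin (dh i)) (Σ i, Fin (dh i)) F)
    (Bh : Matrix (Fin m) (Σ i, Fin (dh i)) F)
    (Ch : Matrix (Σ i, Fin (dh i)) (Fin n) F)
    (Dh : Matrix (Fin m) (Fin n) F)
    (hAh : ∀ x y, Ah x y = if x.1 = y.1 ∧ (x.2 : ℕ) + 1 = (y.2 : ℕ) then 1 else 0)
    (hBh : ∀ i y, Bh i y = if i = y.1 ∧ (y.2 : ℕ) = 0 then 1 else 0)
    (hCh : ∀ x j, Ch x j = (Gh x.1 j).coeff ((x.2 : ℕ) + 1))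
    (hDh : ∀ i j, Dh i j = (Gh i j).coeff 0)
    (Λ : Matrix ((Σ i, Fin (d i)) → F) ((Σ i, Fin (d i)) → F) (Polynomial ℂ))
    (hΛ : ∀ X Y, Λ X Y
      = we {v | ∃ u : Fin k → F, Y = X ᵥ* A + u ᵥ* B ∧ v = X ᵥ* Cm + u ᵥ* D})
    (Λh : Matrix ((Σ i, Fin (dh i)) → F) ((Σ i, Fin (dh i)) → F) (Polynomial ℂ))
    (hΛh : ∀ X Y, Λh X Y
      = we {v | ∃ u : Fin m → F, Y = X ᵥ* Ah + u ᵥ* Bh ∧ v = X ᵥ* Ch + u ᵥ* Dh})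
    (H : Matrix ((Σ i, Fin (d i)) → F) ((Σ i, Fin (d i)) → F) ℂ)
    (hH : ∀ X Y, H X Y = ((Real.sqrt (((p : ℝ) ^ s) ^ (∑ i, d i)))⁻¹ : ℂ)
        * ζ ^ (τ (∑ x, X x * Y x)).val) :
    ∃ N : Matrix (Σ i, Fin (d i)) (Σ i, Fin (dh i)) F,
      (-(Bhᵀ * Dh * Cmᵀ)) * N = 1 ∧ N * (-(Bhᵀ * Dh * Cmᵀ)) = 1 ∧
      Λh = ((Fintype.card F : ℂ) ^ k)⁻¹ •
        ((Matrix.of (fun (X : (Σ i, Fin (dh i)) → F) (Y : (Σ i, Fin (d i)) → F) =>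
              if Y = X ᵥ* (-(Bhᵀ * Dh * Cmᵀ)) then (1 : Polynomial ℂ) else 0)
            * H.map Polynomial.C * Λᵀ * (H⁻¹).map Polynomial.C
            * Matrix.of (fun (X : (Σ i, Fin (d i)) → F) (Y : (Σ i, Fin (dh i)) → F) =>
                if Y = X ᵥ* N then (1 : Polynomial ℂ) else 0)).map
          (macwTrafo (Fintype.card F) n)) := by
  classical
  obtain ⟨ψ, hψ, hψτ⟩ := aux_char hs hq ζ hζ τ hτ
  have hcard : Fintype.card (Σ i, Fin (dh i)) = Fintype.card (Σ i, Fin (d i)) := by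
    simp [hrhat]
  -- coefficient form of orthogonality
  have orth0 : ∀ i i', ∑ j, (G i j).coeff 0 * (Gh i' j).coeff 0 = 0 := by
    intro i i'
    have h := congrArg (fun f => (f i i').coeff 0) horth
    simpa [Matrix.mul_apply, Polynomial.finsetSum_coeff, Polynomial.mul_coeff_zero] using h
  have orthS : ∀ i i' t, ∑ j, (G i j).coeff (t + 1) * (Gh i' j).coeff 0
      + ∑ j, (G i j).coeff t * (Gh i' j).coeff 1 = 0 := by
    intro i i' t
    have h := congrArg (fun f => (f i i').coeff (t + 1)) horth
    simp only [Matrix.mul_apply, Polynomial.finsetSum_coeff, Matrix.transpose_apply,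
      Matrix.zero_apply, Polynomial.coeff_zero] at h
    rw [← h, ← Finset.sum_add_distrib]
    apply Finset.sum_congr rfl
    intro j _
    have hd : (Gh i' j).natDegree ≤ 1 := (hGhdeg i' j).trans (hdh1 i')
    conv_rhs => rw [Polynomial.eq_X_add_C_of_natDegree_le_one hd, mul_add, ← mul_assoc,
      Polynomial.coeff_add, Polynomial.coeff_mul_X, Polynomial.coeff_mul_C, Polynomial.coeff_mul_C]
    ring
  have Gbig : ∀ i j t, d i < t → (G i j).coeff t = 0 := fun i j t h =>
    Polynomial.coeff_eq_zero_of_natDegree_lt (lt_of_le_of_lt (hGdeg i j) h)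
  have hyz : ∀ y : Σ i, Fin (dh i), (y.2 : ℕ) = 0 := by
    intro y
    have h1 := y.2.2
    have h2 := hdh1 y.1
    omega
  have hyeq : ∀ y y' : Σ i, Fin (dh i), y.1 = y'.1 ↔ y = y' := by
    rintro ⟨i, a⟩ ⟨i', a'⟩
    constructor
    · intro h
      simp only at h
      subst h
      have h1 := hyz ⟨i, a⟩
      have h2 := hyz ⟨i, a'⟩
      simp only at h1 h2
      congr 1
      exact Fin.ext (h1.trans h2.symm)
    · intro h; rw [h]
  have hBh' : ∀ i y, Bh i y = if i = y.1 then 1 else 0 := by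
    intro i y
    rw [hBh]
    simp [hyz y]
  have hAh0 : Ah = 0 := by
    ext x y
    rw [hAh]
    have := hyz y
    simp [this]
  have hBB : Bhᵀ * Bh = 1 := by
    ext y y'
    simp only [Matrix.mul_apply, Matrix.transpose_apply, hBh', Matrix.one_apply]
    simp [hyeq, eq_comm]
  set M := Bhᵀ * Dh * Cmᵀ with hM
  have hMe : ∀ z y, Mᵀ z y = ∑ j, (G z.1 j).coeff ((z.2 : ℕ) + 1) * (Gh y.1 j).coeff 0 := by
    intro z y
    rw [Matrix.transpose_apply, hM, Matrix.mul_apply]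
    apply Finset.sum_congr rfl
    intro j _
    rw [Matrix.mul_apply, Matrix.transpose_apply, hC, mul_comm]
    congr 1
    simp [hBh', hDh]
  have sumA : ∀ (f : Fin k → ℕ → F), (∀ i t, d i < t → f i t = 0) → ∀ x : Σ i, Fin (d i),
      ∑ z, A x z * f z.1 ((z.2 : ℕ) + 1) = f x.1 ((x.2 : ℕ) + 2) := by
    intro f hf x
    by_cases hx : (x.2 : ℕ) + 1 < d x.1
    · rw [Finset.sum_eq_single (⟨x.1, ⟨(x.2 : ℕ) + 1, hx⟩⟩ : Σ i, Fin (d i))]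
      · simp [hA]
      · rintro ⟨i, a⟩ _ hne
        rw [hA, if_neg, zero_mul]
        rintro ⟨h1, h2⟩
        apply hne
        simp only at h1 h2
        subst h1
        congr 1
        exact Fin.ext h2.symm
      · simp
    · rw [hf _ _ (by omega)]
      apply Finset.sum_eq_zero
      rintro ⟨i, a⟩ _
      rw [hA, if_neg, zero_mul]
      rintro ⟨h1, h2⟩
      simp only at h1 h2
      subst h1
      have := a.2
      omega
  have sumB : ∀ (f : Fin k → ℕ → F), (∀ i t, d i < t → f i t = 0) → ∀ i : Fin k,
      ∑ z, B i z * f z.1 ((z.2 : ℕ) + 1) = f i 1 := by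
    intro f hf i
    by_cases hx : 0 < d i
    · rw [Finset.sum_eq_single (⟨i, ⟨0, hx⟩⟩ : Σ i, Fin (d i))]
      · simp [hB]
      · rintro ⟨i', a⟩ _ hne
        rw [hB, if_neg, zero_mul]
        rintro ⟨h1, h2⟩
        apply hne
        simp only at h1 h2
        subst h1
        congr 1
        exact Fin.ext h2
      · simp
    · rw [hf _ _ (by omega)]
      apply Finset.sum_eq_zero
      rintro ⟨i', a⟩ _
      rw [hB, if_neg, zero_mul]
      rintro ⟨h1, h2⟩
      simp only at h1 h2
      subst h1
      have := a.2
      omega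
  have e1 : A * Mᵀ + Cm * Chᵀ = 0 := by
    ext x y
    simp only [Matrix.add_apply, Matrix.mul_apply, hMe, Matrix.zero_apply]
    rw [sumA (fun i t => ∑ j, (G i j).coeff t * (Gh y.1 j).coeff 0)
      (fun i t h => Finset.sum_eq_zero (fun j _ => by rw [Gbig i j t h, zero_mul]))]
    simp only [Matrix.transpose_apply, hC, hCh, hyz y]
    exact orthS x.1 y.1 _
  have e2 : B * Mᵀ + D * Chᵀ = 0 := by
    ext x y
    simp only [Matrix.add_apply, Matrix.mul_apply, hMe, Matrix.zero_apply]
    rw [sumB (fun i t => ∑ j, (G i j).coeff t * (Gh y.1 j).coeff 0)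
      (fun i t h => Finset.sum_eq_zero (fun j _ => by rw [Gbig i j t h, zero_mul]))]
    simp only [Matrix.transpose_apply, hD, hCh, hyz y]
    exact orthS x y.1 0
  have e3 : Cm * Dhᵀ = Mᵀ * Bhᵀ := by
    ext x i
    simp only [Matrix.mul_apply, hMe, Matrix.transpose_apply, hC, hDh, hBh']
    rcases (show dh i = 0 ∨ dh i = 1 by have := hdh1 i; omega) with h0 | h0
    · rw [Finset.sum_eq_zero (f := fun y : Σ i, Fin (dh i) => _)]
      · have h := orthS x.1 i (x.2 : ℕ)
        rw [Finset.sum_eq_zero (f := fun j => (G x.1 j).coeff (x.2 : ℕ) * (Gh i j).coeff 1)] at h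
        · simpa using h
        · intro j _
          rw [Polynomial.coeff_eq_zero_of_natDegree_lt (p := Gh i j), mul_zero]
          have := hGhdeg i j
          omega
      · rintro ⟨i', a⟩ _
        rw [if_neg, mul_zero]
        intro h
        simp only at h
        subst h
        have := a.2
        omega
    · rw [Finset.sum_eq_single (⟨i, ⟨0, by omega⟩⟩ : Σ i, Fin (dh i))]
      · simp
      · intro y _ hne
        rw [if_neg, mul_zero]
        intro h
        exact hne ((hyeq _ _).mp h.symm)
      · simp
  have e4 : D * Dhᵀ = 0 := by
    ext i i'
    simpa [Matrix.mul_apply, hD, hDh] using orth0 i i'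
  have key : ∀ b : Fin n → F, Cm *ᵥ b = 0 → D *ᵥ b = 0 →
      ∃ u : Fin m → F, Bhᵀ *ᵥ u = 0 ∧ b = Dhᵀ *ᵥ u := by
    intro b h1 h2
    obtain ⟨u, hu1, hu2⟩ := aux_key hkm G hGbasic Gh dh hGhdeg hGhbasic hGhmin horth hdh1 b (by
      intro i t
      rcases t with _ | t
      · simpa [Matrix.mulVec, dotProduct, hD] using congrFun h2 i
      · by_cases ht : t < d i
        · simpa [Matrix.mulVec, dotProduct, hC] using congrFun h1 ⟨i, ⟨t, ht⟩⟩
        · apply Finset.sum_eq_zero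
          intro j _
          rw [Gbig i j _ (by omega), zero_mul])
    refine ⟨u, ?_, ?_⟩
    · ext y
      have h3 := hu1 y.1 (by have := hdh1 y.1; have := y.2.2; omega)
      simp [Matrix.mulVec, dotProduct, hBh', h3]
    · ext j
      rw [hu2 j]
      simp [Matrix.mulVec, dotProduct, hDh, mul_comm]
  have hMinj : ∀ w : (Σ i, Fin (dh i)) → F, Mᵀ *ᵥ w = 0 → w = 0 := by
    intro w hw
    have hMt : Mᵀ = Cm * Dhᵀ * Bh := by
      rw [e3, Matrix.mul_assoc, hBB, Matrix.mul_one]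
    obtain ⟨u, hu1, hu2⟩ := key (Dhᵀ *ᵥ (Bh *ᵥ w))
      (by rw [← hw, hMt]; simp only [Matrix.mulVec_mulVec, Matrix.mul_assoc])
      (by rw [Matrix.mulVec_mulVec, e4, Matrix.zero_mulVec])
    rw [← sub_eq_zero, ← Matrix.mulVec_sub, Matrix.mulVec_transpose] at hu2
    have h3 := sub_eq_zero.mp (aux_rows_inj Gh hGhbasic Dh hDh _ hu2)
    rw [← h3, Matrix.mulVec_mulVec, hBB, Matrix.one_mulVec] at hu1
    exact hu1
  obtain ⟨N, hN1, hN2⟩ := aux_inverse hcard M hMinj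
  refine ⟨N, hN1, hN2, ?_⟩
  ext1 X Y
  have hq0 : (Fintype.card F : ℂ) ≠ 0 := by simp
  have hmat : (Matrix.of (fun (X : (Σ i, Fin (dh i)) → F) (Y : (Σ i, Fin (d i)) → F) =>
              if Y = X ᵥ* (-M) then (1 : Polynomial ℂ) else 0)
            * H.map Polynomial.C * Λᵀ * (H⁻¹).map Polynomial.C
            * Matrix.of (fun (X : (Σ i, Fin (d i)) → F) (Y : (Σ i, Fin (dh i)) → F) =>
                if Y = X ᵥ* N then (1 : Polynomial ℂ) else 0)) X Y
      = (H.map Polynomial.C * Λᵀ * (H⁻¹).map Polynomial.C) (X ᵥ* (-M)) (Y ᵥ* (-M)) := by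
    have hiff : ∀ Z : (Σ i, Fin (d i)) → F, Y = Z ᵥ* N ↔ Z = Y ᵥ* (-M) := by
      intro Z
      constructor
      · rintro rfl
        rw [Matrix.vecMul_vecMul, hN2, Matrix.vecMul_one]
      · rintro rfl
        rw [Matrix.vecMul_vecMul, hN1, Matrix.vecMul_one]
    rw [Matrix.mul_apply]
    simp only [Matrix.of_apply, hiff]
    simp only [mul_ite, mul_one, mul_zero, Finset.sum_ite_eq', Finset.mem_univ, if_true]
    rw [Matrix.mul_assoc, Matrix.mul_assoc, Matrix.mul_apply, ← Matrix.mul_assoc]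
    simp only [Matrix.of_apply]
    simp only [ite_mul, one_mul, zero_mul, Finset.sum_ite_eq', Finset.sum_ite_eq, Finset.mem_univ, if_true]
  rw [Matrix.smul_apply, Matrix.map_apply, hmat]
  have htr := aux_transform ψ hψ A B Cm D (aux_rows_inj G hGbasic D hD) Λ hΛ H
    ((Real.sqrt (((p : ℝ) ^ s) ^ (∑ i, d i)))⁻¹ : ℂ) (by
      rw [← mul_inv, ← Complex.ofReal_mul, Real.mul_self_sqrt (by positivity), hq]
      have hp : (p : ℂ) ≠ 0 := by exact_mod_cast (Fact.out : p.Prime).ne_zero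
      push_cast
      simp only [Fintype.card_sigma, Fintype.card_fin]
      exact inv_mul_cancel₀ (pow_ne_zero _ (pow_ne_zero _ hp)))
    (by intro X Y; rw [hH, hψτ]; rfl) (X ᵥ* (-M)) (Y ᵥ* (-M))
  rw [Fintype.card_fin] at htr
  rw [htr, hΛh]
  apply aux_we_neg
  intro a
  have hXM : ∀ Z, Z ᵥ* (-M) = -(Mᵀ *ᵥ Z) := by
    intro Z
    rw [Matrix.vecMul_neg, Matrix.mulVec_transpose]
  have e1X : A *ᵥ (Mᵀ *ᵥ X) = -(Cm *ᵥ (Chᵀ *ᵥ X)) := by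
    rw [eq_neg_iff_add_eq_zero, Matrix.mulVec_mulVec, Matrix.mulVec_mulVec, ← Matrix.add_mulVec,
      e1, Matrix.zero_mulVec]
  have e2X : B *ᵥ (Mᵀ *ᵥ X) = -(D *ᵥ (Chᵀ *ᵥ X)) := by
    rw [eq_neg_iff_add_eq_zero, Matrix.mulVec_mulVec, Matrix.mulVec_mulVec, ← Matrix.add_mulVec,
      e2, Matrix.zero_mulVec]
  have e3u : ∀ u, Cm *ᵥ (Dhᵀ *ᵥ u) = Mᵀ *ᵥ (Bhᵀ *ᵥ u) := by
    intro u
    rw [Matrix.mulVec_mulVec, Matrix.mulVec_mulVec, e3]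
  have e4u : ∀ u, D *ᵥ (Dhᵀ *ᵥ u) = 0 := by
    intro u
    rw [Matrix.mulVec_mulVec, e4, Matrix.zero_mulVec]
  simp only [Set.mem_ofPred_eq, hXM, Matrix.mulVec_neg, e1X, e2X, hAh0, Matrix.vecMul_zero,
    zero_add, neg_neg, sub_neg_eq_add]
  simp only [← Matrix.mulVec_transpose]
  constructor
  · rintro ⟨u, rfl, rfl⟩
    simp only [Matrix.mulVec_add, e3u, e4u]
    constructor
    · abel
    · simp
  · rintro ⟨h1, h2⟩
    have hYe : Bhᵀ *ᵥ (Bh *ᵥ Y) = Y := by rw [Matrix.mulVec_mulVec, hBB, Matrix.one_mulVec]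
    obtain ⟨u, hu1, hu2⟩ := key (a - Chᵀ *ᵥ X - Dhᵀ *ᵥ (Bh *ᵥ Y))
      (by
        rw [Matrix.mulVec_sub, Matrix.mulVec_sub, e3u, hYe, ← neg_eq_zero, ← h1]
        abel)
      (by
        rw [Matrix.mulVec_sub, Matrix.mulVec_sub, e4u, sub_zero, ← neg_eq_zero, ← h2]
        abel)
    refine ⟨Bh *ᵥ Y + u, ?_, ?_⟩
    · rw [Matrix.mulVec_add, hYe, hu1, add_zero]
    · rw [Matrix.mulVec_add, ← hu2]
      abel
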